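/- arXiv:0801.3257 — 4 statements merged into one kernel-verified Lean document; each statement's English description precedes it below -/
import Mathlib

section
/- (Cotlar's Lemma.) Let (Ω, μ) be a measure space and let {U_j : j ∈ ℕ} be bounded linear operators on L²(μ). Suppose {a(j) : j ∈ ℤ} are non-negative real numbers with Σ_{j∈ℤ} a(j) = A < ∞, and that the operator norms satisfy max(‖U_j U_k*‖, ‖U_j* U_k‖) ≤ a(j−k)² for all j, k ∈ ℕ. Then for every N ∈ ℕ, ‖Σ_{j=0}^N U_j‖ ≤ A. -/
open MeasureTheory

theorem le_of_forall_pow_two_pow_le_mul {x y C : ℝ} (hy : 0 ≤ y)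
    (h : ∀ n : ℕ, x ^ 2 ^ n ≤ C * y ^ 2 ^ n) : x ≤ y := by
  by_contra! hlt
  rcases hy.eq_or_lt with rfl | hy
  · have := h 0
    simp at this
    linarith
  obtain ⟨n, hn⟩ := pow_unbounded_of_one_lt C ((one_lt_div hy).2 hlt)
  have hmono : (x / y) ^ n ≤ (x / y) ^ 2 ^ n :=
    pow_le_pow_right₀ ((one_lt_div hy).2 hlt).le Nat.lt_two_pow_self.le
  have hle : (x / y) ^ 2 ^ n ≤ C := by
    rw [div_pow, div_le_iff₀ (by positivity)]
    exact h n
  linarith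

/-- `AlmostOrthogonalSum U K A j c Z` says that `Z` is a finite sum of elements `X` (thought of as
words starting with `star (U j)`), each satisfying the two norm estimates obtained by grouping
adjacent letters in the two possible ways, where the geometric means `p * q` of these
estimates add up to at most `c`. -/
inductive AlmostOrthogonalSum {R ι : Type*} [NormedRing R] (U : ι → R) (K : ι → ι → ℝ) (A : ℝ)
    (j : ι) : ℝ → R → Prop
  | word {c p q : ℝ} {X : R} (hp : 0 ≤ p) (hq : 0 ≤ q) (hpq : p * q ≤ c) (hXp : ‖X‖ ≤ p ^ 2)
      (hXq : ‖X‖ ≤ A ^ 2 * q ^ 2) (hUX : ∀ i, ‖U i * X‖ ≤ K i j ^ 2 * (A * q ^ 2)) :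
      AlmostOrthogonalSum U K A j c X
  | add {c d : ℝ} {X Y : R} (hX : AlmostOrthogonalSum U K A j c X)
      (hY : AlmostOrthogonalSum U K A j d Y) : AlmostOrthogonalSum U K A j (c + d) (X + Y)

namespace AlmostOrthogonalSum

variable {R ι : Type*} [NormedRing R] {U : ι → R} {K : ι → ι → ℝ} {A : ℝ} {j : ι}

theorem zero {c : ℝ} (hc : 0 ≤ c) : AlmostOrthogonalSum U K A j c 0 :=
  word le_rfl le_rfl (by simpa using hc) (by simp) (by simp) (by simp)

theorem mono {c d : ℝ} {X : R} (hX : AlmostOrthogonalSum U K A j c X) (hcd : c ≤ d) :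
    AlmostOrthogonalSum U K A j d X := by
  simpa using hX.add (zero (sub_nonneg.2 hcd))

theorem sum {κ : Type*} (s : Finset κ) {c : κ → ℝ} {X : κ → R}
    (h : ∀ i, AlmostOrthogonalSum U K A j (c i) (X i)) :
    AlmostOrthogonalSum U K A j (∑ i ∈ s, c i) (∑ i ∈ s, X i) := by
  classical
  induction s using Finset.induction_on with
  | empty => simpa using zero le_rfl
  | insert i s hi ih =>
    rw [Finset.sum_insert hi, Finset.sum_insert hi]
    exact (h i).add ih

theorem norm_le (hA : 0 ≤ A) {c : ℝ} {X : R} (h : AlmostOrthogonalSum U K A j c X) :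
    ‖X‖ ≤ A * c := by
  induction h with
  | @word c p q X hp hq hpq hXp hXq _ =>
    have h1 : ‖X‖ ≤ A * (p * q) := by
      refine le_of_pow_le_pow_left₀ two_ne_zero (by positivity) ?_
      calc ‖X‖ ^ 2 = ‖X‖ * ‖X‖ := sq _
        _ ≤ p ^ 2 * (A ^ 2 * q ^ 2) := by gcongr
        _ = (A * (p * q)) ^ 2 := by ring
    exact h1.trans (by gcongr)
  | @add c d X Y _ _ hX hY =>
    calc ‖X + Y‖ ≤ ‖X‖ + ‖Y‖ := norm_add_le _ _
      _ ≤ A * (c + d) := by linarith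

variable [StarRing R] [CStarRing R]

theorem star_mul_mul (hK : ∀ i j, 0 ≤ K i j) (hU : ∀ i, ‖U i‖ ≤ A)
    (h₁ : ∀ i j, ‖U i * star (U j)‖ ≤ K i j ^ 2) (h₂ : ∀ i j, ‖star (U i) * U j‖ ≤ K i j ^ 2)
    {c : ℝ} {X : R} (h : AlmostOrthogonalSum U K A j c X) (i k : ι) :
    AlmostOrthogonalSum U K A i (K i k * K k j * c) (star (U i) * (U k * X)) := by
  induction h with
  | @word c p q X hp hq hpq hXp _ hUX =>
    refine word (mul_nonneg (hK i k) hp) (mul_nonneg (hK k j) hq) ?_ ?_ ?_ fun l ↦ ?_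
    · calc K i k * p * (K k j * q) = K i k * K k j * (p * q) := by ring
        _ ≤ _ := mul_le_mul_of_nonneg_left hpq (mul_nonneg (hK _ _) (hK _ _))
    · rw [← mul_assoc, mul_pow]
      exact norm_mul_le_of_le (h₂ i k) hXp
    · calc ‖star (U i) * (U k * X)‖ ≤ A * (K k j ^ 2 * (A * q ^ 2)) :=
            norm_mul_le_of_le ((norm_star _).trans_le (hU i)) (hUX k)
        _ = A ^ 2 * (K k j * q) ^ 2 := by ring
    · calc ‖U l * (star (U i) * (U k * X))‖ = ‖U l * star (U i) * (U k * X)‖ := by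
            rw [mul_assoc]
        _ ≤ K l i ^ 2 * (K k j ^ 2 * (A * q ^ 2)) := norm_mul_le_of_le (h₁ l i) (hUX k)
        _ = K l i ^ 2 * (A * (K k j * q) ^ 2) := by ring
  | add _ _ hX hY =>
    rw [mul_add, mul_add, mul_add]
    exact hX.add hY

theorem star_mul (hK : ∀ i j, 0 ≤ K i j) (hU : ∀ i, ‖U i‖ ≤ A)
    (h₁ : ∀ i j, ‖U i * star (U j)‖ ≤ K i j ^ 2) (h₂ : ∀ i j, ‖star (U i) * U j‖ ≤ K i j ^ 2)
    (i k : ι) : AlmostOrthogonalSum U K A i (K i k) (star (U i) * U k) := by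
  refine word (hK i k) zero_le_one (mul_one _).le (h₂ i k) ?_ fun l ↦ ?_
  · rw [one_pow, mul_one, sq]
    exact norm_mul_le_of_le ((norm_star _).trans_le (hU i)) (hU k)
  · rw [← mul_assoc, one_pow, mul_one]
    exact norm_mul_le_of_le (h₁ l i) (hU k)

theorem star_mul_sum_mul_pow [Fintype ι] (hA : 0 ≤ A) (hK : ∀ i j, 0 ≤ K i j)
    (hKA : ∀ i, ∑ j, K i j ≤ A) (hU : ∀ i, ‖U i‖ ≤ A)
    (h₁ : ∀ i j, ‖U i * star (U j)‖ ≤ K i j ^ 2) (h₂ : ∀ i j, ‖star (U i) * U j‖ ≤ K i j ^ 2)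
    (m : ℕ) (i : ι) :
    AlmostOrthogonalSum U K A i (A ^ (2 * m + 1))
      (star (U i) * ((∑ k, U k) * (star (∑ k, U k) * ∑ k, U k) ^ m)) := by
  induction m generalizing i with
  | zero =>
    simpa [Finset.mul_sum] using (sum Finset.univ (star_mul hK hU h₁ h₂ i)).mono (hKA i)
  | succ m ih =>
    have hsum := sum Finset.univ fun k ↦ sum Finset.univ fun j ↦
      (ih j).star_mul_mul hK hU h₁ h₂ i k
    convert hsum.mono ?_ using 1
    · simp only [← Finset.mul_sum, ← Finset.sum_mul, ← star_sum]
      rw [pow_succ']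
      simp only [mul_assoc]
    · calc ∑ k, ∑ j, K i k * K k j * A ^ (2 * m + 1)
          = ∑ k, K i k * ((∑ j, K k j) * A ^ (2 * m + 1)) := by
            simp only [Finset.sum_mul, Finset.mul_sum, mul_assoc]
        _ ≤ ∑ k, K i k * (A * A ^ (2 * m + 1)) := by
            gcongr with k
            · exact hK i k
            · exact hKA k
        _ = (∑ k, K i k) * (A * A ^ (2 * m + 1)) := by rw [Finset.sum_mul]
        _ ≤ A * (A * A ^ (2 * m + 1)) := by
            gcongr
            exact hKA i
        _ = A ^ (2 * (m + 1) + 1) := by ring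

end AlmostOrthogonalSum

/-- The **Cotlar–Stein lemma** for finite families in a C⋆-ring. -/
theorem CStarRing.norm_sum_le_of_almost_orthogonal {R ι : Type*} [NormedRing R] [StarRing R]
    [CStarRing R] [Fintype ι] {U : ι → R} {K : ι → ι → ℝ} {A : ℝ} (hA : 0 ≤ A)
    (hK : ∀ i j, 0 ≤ K i j) (hKA : ∀ i, ∑ j, K i j ≤ A)
    (h₁ : ∀ i j, ‖U i * star (U j)‖ ≤ K i j ^ 2)
    (h₂ : ∀ i j, ‖star (U i) * U j‖ ≤ K i j ^ 2) : ‖∑ i, U i‖ ≤ A := by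
  have hU (i : ι) : ‖U i‖ ≤ A := by
    have hKi : ‖U i‖ ≤ K i i := by
      refine le_of_pow_le_pow_left₀ two_ne_zero (hK i i) ?_
      rw [sq, ← CStarRing.norm_star_mul_self]
      exact h₂ i i
    exact hKi.trans ((Finset.single_le_sum (fun j _ ↦ hK i j) (Finset.mem_univ i)).trans (hKA i))
  set S := ∑ i, U i
  refine le_of_pow_le_pow_left₀ two_ne_zero hA ?_
  refine le_of_forall_pow_two_pow_le_mul (C := Fintype.card ι) (by positivity) fun n ↦ ?_
  obtain ⟨m, hm⟩ := Nat.exists_eq_add_of_le' (Nat.one_le_two_pow (n := n))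
  have hpow : (star S * S) ^ 2 ^ n = ∑ i, star (U i) * (S * (star S * S) ^ m) := by
    rw [hm, pow_succ', ← Finset.sum_mul, ← star_sum, mul_assoc]
  calc (‖S‖ ^ 2) ^ 2 ^ n = ‖(star S * S) ^ 2 ^ n‖ := by
        have h := (IsSelfAdjoint.star_mul_self S).nnnorm_pow_two_pow n
        rw [sq, ← CStarRing.norm_star_mul_self]
        exact (congrArg NNReal.toReal h).symm
    _ ≤ ∑ _i : ι, A * A ^ (2 * m + 1) := by
        rw [hpow]
        exact norm_sum_le_of_le _ fun i _ ↦
          (AlmostOrthogonalSum.star_mul_sum_mul_pow hA hK hKA hU h₁ h₂ m i).norm_le hA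
    _ = Fintype.card ι * (A ^ 2) ^ 2 ^ n := by
        rw [hm, Finset.sum_const, Finset.card_univ, nsmul_eq_mul]
        ring

/-- **Cotlar's Lemma.** Let `{U_j : j ∈ ℕ}` be bounded operators on `L²(μ)` and
`{a(j) : j ∈ ℤ}` nonnegative reals with `Σ_{j∈ℤ} a(j) = A < ∞`, such that
`max(‖U_j U_k*‖, ‖U_j* U_k‖) ≤ a(j−k)²` for all `j, k ∈ ℕ`. Then for every `N`,
`‖Σ_{j=0}^N U_j‖ ≤ A`. -/
theorem cotlar_lemma {Ω : Type*} [MeasurableSpace Ω] (μ : Measure Ω)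
    (U : ℕ → Lp ℝ 2 μ →L[ℝ] Lp ℝ 2 μ)
    (a : ℤ → ℝ) (ha : ∀ j, 0 ≤ a j) (hsum : Summable a)
    (hbound : ∀ j k : ℕ,
      max ‖(U j).comp (ContinuousLinearMap.adjoint (U k))‖
          ‖(ContinuousLinearMap.adjoint (U j)).comp (U k)‖ ≤ a ((j : ℤ) - (k : ℤ)) ^ 2) :
    ∀ N : ℕ, ‖∑ j ∈ Finset.range (N + 1), U j‖ ≤ ∑' j : ℤ, a j := by
  intro N
  rw [Finset.sum_range]
  refine CStarRing.norm_sum_le_of_almost_orthogonal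
    (K := fun i j : Fin (N + 1) ↦ a ((i : ℤ) - (j : ℤ))) (tsum_nonneg ha) (fun _ _ ↦ ha _)
    (fun i ↦ ?_) (fun i j ↦ (le_max_left _ _).trans (hbound i j))
    (fun i j ↦ (le_max_right _ _).trans (hbound i j))
  have hinj : Function.Injective fun j : Fin (N + 1) ↦ (i : ℤ) - (j : ℤ) := fun j k hjk ↦ by
    simp only at hjk
    omega
  exact (Finset.sum_map Finset.univ ⟨_, hinj⟩ a).symm.trans_le
    (hsum.sum_le_tsum _ fun j _ ↦ ha j)
end

section
/- For every M ≥ 1 there is a constant c = c(M) such that for all b, γ > 0 with max(γ, γ^{-1}, b, b^{-1}) ≤ M, all t > 0, all x ≥ 0, and all p with 0 < p < b/γ: ∫_0^∞ y^{−p} q_t^{b,γ}(x,y) y^{b/γ − 1} dy ≤ c ( p/((b/γ) − p) + 1 ) (x + t)^{−p}. -/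
open MeasureTheory

/-- The transition density `q_t^{b,γ}(x,y)` of the Feller branching diffusion with
immigration (generator `b f' + γ x f''`) with respect to the measure `y^{b/γ−1} dy`. -/
noncomputable def qdens (b γ t x y : ℝ) : ℝ :=
  (γ * t) ^ (-(b / γ)) * Real.exp (-(x + y) / (γ * t)) *
    ∑' m : ℕ, (1 / ((m.factorial : ℝ) * Real.Gamma ((m : ℝ) + b / γ))) *
      (x / (γ * t)) ^ m * (y / (γ * t)) ^ m

/-- A lower bound for the growth of `Γ`, from its logarithmic convexity. -/
theorem rpow_mul_Gamma_le_Gamma_add {x p : ℝ} (hx : 0 < x) (hp : 0 < p) :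
    x ^ p * Real.Gamma (x + 1) ≤ Real.Gamma (x + 1 + p) := by
  have h := Real.convexOn_log_Gamma.slope_mono_adjacent (x := x) (y := x + 1) (z := x + 1 + p)
    (Set.mem_Ioi.2 hx) (Set.mem_Ioi.2 (by linarith)) (by linarith) (by linarith)
  have hG : 0 < Real.Gamma x := Real.Gamma_pos_of_pos hx
  have hG1 : 0 < Real.Gamma (x + 1) := Real.Gamma_pos_of_pos (by linarith)
  have hG2 : 0 < Real.Gamma (x + 1 + p) := Real.Gamma_pos_of_pos (by linarith)
  simp only [Function.comp_apply, add_sub_cancel_left, div_one] at h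
  rw [Real.Gamma_add_one hx.ne', Real.log_mul hx.ne' hG.ne', add_sub_cancel_right,
    le_div_iff₀ hp, ← Real.log_mul hx.ne' hG.ne', ← Real.Gamma_add_one hx.ne'] at h
  rw [← Real.log_le_log_iff (by positivity) hG2, Real.log_mul (by positivity) hG1.ne',
    Real.log_rpow hx]
  linarith

theorem Gamma_div_Gamma_le (m : ℕ) {p q : ℝ} (hp : 0 < p) (hq : 0 < q) :
    Real.Gamma (m + q) / Real.Gamma (m + (q + p)) ≤
      (q + p) / q * (1 + (q + p)) * ((m : ℝ) + 1) ^ (-p) := by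
  have hm : (0 : ℝ) ≤ m := m.cast_nonneg
  have hmono : ((m : ℝ) + 1) ^ p ≤ (m + q + 1) ^ p :=
    Real.rpow_le_rpow (by positivity) (by linarith) hp.le
  have hpow : 0 < ((m : ℝ) + 1) ^ p := by positivity
  have hgrowth := rpow_mul_Gamma_le_Gamma_add (x := (m : ℝ) + q + 1) (by positivity) hp
  rw [show (m : ℝ) + q + 1 + 1 + p = m + (q + p) + 1 + 1 by ring,
    Real.Gamma_add_one (s := (m : ℝ) + q + 1) (by positivity),
    Real.Gamma_add_one (s := (m : ℝ) + q) (by positivity),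
    Real.Gamma_add_one (s := (m : ℝ) + (q + p) + 1) (by positivity),
    Real.Gamma_add_one (s := (m : ℝ) + (q + p)) (by positivity)] at hgrowth
  have hG : 0 < Real.Gamma (m + q) := Real.Gamma_pos_of_pos (by positivity)
  have hG' : 0 < Real.Gamma (m + (q + p)) := Real.Gamma_pos_of_pos (by positivity)
  rw [Real.rpow_neg (by positivity), div_le_iff₀ hG']
  have h1 : (m : ℝ) + (q + p) ≤ (q + p) / q * (m + q) := by
    rw [div_mul_eq_mul_div, le_div_iff₀ hq]
    nlinarith [mul_nonneg hm hp.le]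
  have h2 : (m : ℝ) + (q + p) + 1 ≤ (1 + (q + p)) * (m + q + 1) := by
    nlinarith [mul_nonneg hm hp.le, mul_nonneg hm hq.le, mul_pos hp hq, mul_pos hq hq]
  have h3 : ((m : ℝ) + (q + p) + 1) * ((m + (q + p)) * Real.Gamma (m + (q + p))) ≤
      (1 + (q + p)) * (m + q + 1) * ((q + p) / q * (m + q) * Real.Gamma (m + (q + p))) := by
    gcongr
  have h4 : ((m : ℝ) + 1) ^ p * ((m + q + 1) * ((m + q) * Real.Gamma (m + q))) ≤
      (m + q + 1) ^ p * ((m + q + 1) * ((m + q) * Real.Gamma (m + q))) := by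
    gcongr
  have h5 : ((m : ℝ) + 1) ^ p * Real.Gamma (m + q) ≤
      (q + p) / q * (1 + (q + p)) * Real.Gamma (m + (q + p)) := by
    refine le_of_mul_le_mul_left ?_ (show 0 < ((m : ℝ) + q + 1) * (m + q) by positivity)
    linarith
  calc Real.Gamma (m + q) = (((m : ℝ) + 1) ^ p)⁻¹ * (((m : ℝ) + 1) ^ p * Real.Gamma (m + q)) := by
        field_simp
    _ ≤ (((m : ℝ) + 1) ^ p)⁻¹ * ((q + p) / q * (1 + (q + p)) * Real.Gamma (m + (q + p))) := by
        gcongr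
    _ = _ := by ring

theorem factorial_add_le (m k : ℕ) :
    (m + k).factorial ≤ k.factorial * m.factorial * (m + 1) ^ k := by
  induction k with
  | zero => simp
  | succ k ih =>
    rw [← add_assoc, Nat.factorial_succ, Nat.factorial_succ, pow_succ]
    calc (m + k + 1) * (m + k).factorial
        ≤ ((k + 1) * (m + 1)) * (k.factorial * m.factorial * (m + 1) ^ k) := by
          gcongr; nlinarith [Nat.zero_le (m * k)]
      _ = _ := by ring

/-- Pointwise form of the bound on negative moments of a shifted Poisson variable. -/
theorem poisson_weight_mul_rpow_neg_le (m k : ℕ) {z p : ℝ} (hz : 0 ≤ z) (hp : 0 < p) (hpk : p ≤ k) :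
    z ^ m / m.factorial * ((m : ℝ) + 1) ^ (-p) ≤
      (1 + z) ^ (-p) * ((1 + 2 ^ k) * (z ^ m / m.factorial) +
        2 ^ k * k.factorial * (z ^ (m + k) / (m + k).factorial)) := by
  have hm : (0 : ℝ) < (m : ℝ) + 1 := by positivity
  have hratio : ((1 + z) / ((m : ℝ) + 1)) ^ p ≤ 1 + ((1 + z) / ((m : ℝ) + 1)) ^ k := by
    have h0 : 0 ≤ ((1 + z) / ((m : ℝ) + 1)) := by positivity
    rcases le_total ((1 + z) / ((m : ℝ) + 1)) 1 with h | h
    · have := Real.rpow_le_one h0 h hp.le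
      have : 0 ≤ ((1 + z) / ((m : ℝ) + 1)) ^ k := by positivity
      linarith
    · have := Real.rpow_le_rpow_of_exponent_le h hpk
      rw [Real.rpow_natCast] at this
      linarith
  have hsplit : (1 + z) ^ k ≤ 2 ^ k * (1 + z ^ k) := by
    have h := add_pow_le (zero_le_one) hz k
    rw [one_pow] at h
    refine h.trans ?_
    gcongr
    · norm_num
    · omega
  have hfact : (1 : ℝ) / (m.factorial * ((m : ℝ) + 1) ^ k) ≤
      k.factorial * (1 / (m + k).factorial) := by
    rw [mul_one_div, div_le_div_iff₀ (by positivity) (by positivity)]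
    have h := factorial_add_le m k
    have h' : ((m + k).factorial : ℝ) ≤ k.factorial * m.factorial * ((m : ℝ) + 1) ^ k := by
      exact_mod_cast h
    linarith
  have hone : (1 : ℝ) ≤ ((m : ℝ) + 1) ^ k := one_le_pow₀ (by linarith [m.cast_nonneg (α := ℝ)])
  have hpow : ((m : ℝ) + 1) ^ (-p) = (1 + z) ^ (-p) * ((1 + z) / ((m : ℝ) + 1)) ^ p := by
    rw [Real.div_rpow (by positivity) hm.le, Real.rpow_neg hm.le, Real.rpow_neg (by positivity)]
    have : 0 < (1 + z) ^ p := by positivity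
    field_simp
  have hfrac : z ^ m / m.factorial * (1 / ((m : ℝ) + 1) ^ k) ≤ z ^ m / m.factorial :=
    mul_le_of_le_one_right (by positivity) ((div_le_one (by positivity)).2 hone)
  rw [hpow, mul_left_comm]
  refine mul_le_mul_of_nonneg_left ?_ (by positivity)
  calc z ^ m / m.factorial * ((1 + z) / ((m : ℝ) + 1)) ^ p
      ≤ z ^ m / m.factorial * (1 + (2 ^ k * (1 + z ^ k)) / ((m : ℝ) + 1) ^ k) := by
        rw [div_pow] at hratio
        gcongr
        refine hratio.trans ?_
        gcongr
    _ = z ^ m / m.factorial + 2 ^ k * (z ^ m / m.factorial * (1 / ((m : ℝ) + 1) ^ k)) +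
        2 ^ k * z ^ (m + k) * (1 / (m.factorial * ((m : ℝ) + 1) ^ k)) := by
        rw [pow_add]; field_simp; ring
    _ ≤ z ^ m / m.factorial + 2 ^ k * (z ^ m / m.factorial) +
        2 ^ k * z ^ (m + k) * (k.factorial * (1 / (m + k).factorial)) := by
        gcongr
    _ = _ := by ring

theorem summable_and_tsum_exp_shift_le {z : ℝ} (hz : 0 ≤ z) (k : ℕ) :
    Summable (fun m : ℕ => z ^ (m + k) / ((m + k).factorial : ℝ)) ∧
      ∑' m : ℕ, z ^ (m + k) / ((m + k).factorial : ℝ) ≤ Real.exp z := by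
  have hs := Real.summable_pow_div_factorial z
  refine ⟨(summable_nat_add_iff k).2 hs, ?_⟩
  have h := hs.sum_add_tsum_nat_add k
  have h0 : 0 ≤ ∑ i ∈ Finset.range k, z ^ i / (i.factorial : ℝ) :=
    Finset.sum_nonneg fun i _ => by positivity
  rw [Real.exp_eq_exp_ℝ, NormedSpace.exp_eq_tsum_div]
  linarith

/-- The integral against `y^{-p}` of a single term of the series for the density. -/
theorem integrableOn_and_integral_rpow_mul_exp {s r : ℝ} (hs : 0 < s) (hr : 0 < r) :
    IntegrableOn (fun y : ℝ => y ^ (r - 1) * Real.exp (-(1 / s * y))) (Set.Ioi 0) ∧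
      ∫ y in Set.Ioi (0 : ℝ), y ^ (r - 1) * Real.exp (-(1 / s * y)) = s ^ r * Real.Gamma r := by
  have h := Real.integral_rpow_mul_exp_neg_mul_Ioi hr (one_div_pos.2 hs)
  rw [one_div_one_div] at h
  refine ⟨?_, h⟩
  by_contra hn
  rw [integral_undef hn] at h
  have := Real.Gamma_pos_of_pos hr
  have : 0 < s ^ r * Real.Gamma r := by positivity
  linarith

/-- The negative moments of the density, with explicit constants. -/
theorem integral_rpow_neg_mul_qdens_le {b γ t x p : ℝ} (k : ℕ) (hγ : 0 < γ)
    (ht : 0 < t) (hx : 0 ≤ x) (hp : 0 < p) (hpb : p < b / γ) (hpk : p ≤ k) :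
    (∫ y in Set.Ioi (0 : ℝ), y ^ (-p) * qdens b γ t x y * y ^ (b / γ - 1)) ≤
      (p / (b / γ - p) + 1) * (1 + b / γ) * (1 + 2 ^ k + 2 ^ k * k.factorial) *
        (x + γ * t) ^ (-p) := by
  obtain ⟨q, hq⟩ : ∃ q, q = b / γ - p := ⟨_, rfl⟩
  have hq0 : 0 < q := by linarith
  have ha : b / γ = q + p := by linarith
  obtain ⟨s, hsdef⟩ : ∃ s, s = γ * t := ⟨_, rfl⟩
  have hs : 0 < s := by rw [hsdef]; positivity
  simp only [qdens, ha, ← hsdef, add_sub_cancel_right]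
  obtain ⟨z, hzdef⟩ : ∃ z, z = x / s := ⟨_, rfl⟩
  have hz : 0 ≤ z := by rw [hzdef]; positivity
  have hxz : x = s * z := by rw [hzdef]; field_simp
  simp only [← hzdef]
  let C : ℕ → ℝ := fun m => s ^ (-(q + p)) * Real.exp (-z) *
    (1 / ((m.factorial : ℝ) * Real.Gamma (m + (q + p))) * z ^ m * (s ^ m)⁻¹)
  have hC : ∀ m, 0 ≤ C m := fun m => by
    have := Real.Gamma_pos_of_pos (show 0 < (m : ℝ) + (q + p) by positivity)
    positivity
  let F : ℕ → ℝ → ℝ := fun m y => C m * (y ^ ((m : ℝ) + q - 1) * Real.exp (-(1 / s * y)))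
  let B : ℕ → ℝ := fun m => s ^ (-p) * Real.exp (-z) * ((q + p) / q * (1 + (q + p))) *
    ((1 + z) ^ (-p) * ((1 + 2 ^ k) * (z ^ m / m.factorial) +
        2 ^ k * k.factorial * (z ^ (m + k) / (m + k).factorial)))
  have hmom := fun m : ℕ =>
    integrableOn_and_integral_rpow_mul_exp hs (show 0 < (m : ℝ) + q by positivity)
  have hFint : ∀ m, Integrable (F m) (volume.restrict (Set.Ioi 0)) := fun m =>
    (hmom m).1.const_mul _
  have hFval : ∀ m, ∫ y in Set.Ioi (0 : ℝ), F m y = s ^ (-p) * Real.exp (-z) *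
      (z ^ m / m.factorial * (Real.Gamma (m + q) / Real.Gamma (m + (q + p)))) := fun m => by
    have hG := Real.Gamma_pos_of_pos (show 0 < (m : ℝ) + (q + p) by positivity)
    have hsp : s ^ (-(q + p)) * s ^ ((m : ℝ) + q) = s ^ (-p) * s ^ m := by
      rw [← Real.rpow_natCast, ← Real.rpow_add hs, ← Real.rpow_add hs]
      ring_nf
    simp only [F]
    rw [integral_const_mul, (hmom m).2]
    calc _ = (s ^ (-(q + p)) * s ^ ((m : ℝ) + q)) * (Real.exp (-z) *
          (1 / ((m.factorial : ℝ) * Real.Gamma (m + (q + p))) * z ^ m * (s ^ m)⁻¹)) *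
            Real.Gamma (m + q) := by simp only [C]; ring
      _ = _ := by rw [hsp]; field_simp
  have hFle : ∀ m, ∫ y in Set.Ioi (0 : ℝ), F m y ≤ B m := fun m => by
    rw [hFval]
    have h1 := Gamma_div_Gamma_le m hp hq0
    have h2 := poisson_weight_mul_rpow_neg_le m k hz hp hpk
    calc _ ≤ s ^ (-p) * Real.exp (-z) * (z ^ m / m.factorial *
          ((q + p) / q * (1 + (q + p)) * ((m : ℝ) + 1) ^ (-p))) := by gcongr
      _ = s ^ (-p) * Real.exp (-z) * ((q + p) / q * (1 + (q + p))) *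
          (z ^ m / m.factorial * ((m : ℝ) + 1) ^ (-p)) := by ring
      _ ≤ B m := by simp only [B]; gcongr
  have hFnorm : ∀ m, ∫ y in Set.Ioi (0 : ℝ), ‖F m y‖ = ∫ y in Set.Ioi (0 : ℝ), F m y := fun m => by
    refine setIntegral_congr_fun measurableSet_Ioi fun y hy => ?_
    have hy' : (0 : ℝ) < y := hy
    exact Real.norm_of_nonneg (mul_nonneg (hC m) (by positivity))
  have hs0 := Real.summable_pow_div_factorial z
  obtain ⟨hsk, hskle⟩ := summable_and_tsum_exp_shift_le hz k
  have hs0le : ∑' m : ℕ, z ^ m / (m.factorial : ℝ) ≤ Real.exp z := by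
    simpa using (summable_and_tsum_exp_shift_le hz 0).2
  have hBsum : Summable B :=
    (((hs0.mul_left _).add (hsk.mul_left _)).mul_left _).mul_left _
  have hsum : Summable fun m => ∫ y in Set.Ioi (0 : ℝ), ‖F m y‖ := by
    refine Summable.of_nonneg_of_le (fun m => integral_nonneg fun y => norm_nonneg _)
      (fun m => ?_) hBsum
    rw [hFnorm]
    exact hFle m
  have hH := hasSum_integral_of_summable_integral_norm hFint hsum
  have hInt : (∫ y in Set.Ioi (0 : ℝ), y ^ (-p) * (s ^ (-(q + p)) * Real.exp (-(x + y) / s) *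
      ∑' m : ℕ, 1 / ((m.factorial : ℝ) * Real.Gamma ((m : ℝ) + (q + p))) * z ^ m * (y / s) ^ m) *
        y ^ (q + p - 1)) = ∫ y in Set.Ioi (0 : ℝ), ∑' m, F m y := by
    refine setIntegral_congr_fun measurableSet_Ioi fun y hy => ?_
    have hy' : (0 : ℝ) < y := hy
    rw [← tsum_mul_left, ← tsum_mul_left, ← tsum_mul_right]
    refine tsum_congr fun m => ?_
    have hexp : Real.exp (-(x + y) / s) = Real.exp (-z) * Real.exp (-(1 / s * y)) := by
      rw [← Real.exp_add, hxz]
      congr 1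
      field_simp
      ring
    have hpow : y ^ ((m : ℝ) + q - 1) = y ^ (-p) * y ^ m * y ^ (q + p - 1) := by
      rw [← Real.rpow_natCast, ← Real.rpow_add hy', ← Real.rpow_add hy']
      ring_nf
    simp only [F, C]
    rw [hexp, hpow, div_pow, div_eq_mul_inv (y ^ m)]
    ring
  rw [hInt, ← hH.tsum_eq]
  have hscale : (x + s) ^ (-p) = s ^ (-p) * (1 + z) ^ (-p) := by
    rw [← Real.mul_rpow hs.le (by positivity), hxz]
    ring_nf
  have hfactor : p / q + 1 = (q + p) / q := by field_simp; ring
  rw [hscale, hfactor]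
  refine (hH.summable.tsum_le_tsum hFle hBsum).trans ?_
  simp only [B]
  rw [tsum_mul_left, tsum_mul_left, (hs0.mul_left _).tsum_add (hsk.mul_left _), tsum_mul_left,
    tsum_mul_left]
  calc _ ≤ s ^ (-p) * Real.exp (-z) * ((q + p) / q * (1 + (q + p))) *
      ((1 + z) ^ (-p) * ((1 + 2 ^ k) * Real.exp z + 2 ^ k * k.factorial * Real.exp z)) := by
        gcongr
    _ = (Real.exp (-z) * Real.exp z) * ((q + p) / q * (1 + (q + p)) *
        (1 + 2 ^ k + 2 ^ k * k.factorial) * (s ^ (-p) * (1 + z) ^ (-p))) := by ring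
    _ = _ := by rw [← Real.exp_add, neg_add_cancel, Real.exp_zero, one_mul]

/-- For every `M ≥ 1` there is a constant `c = c(M)` such that for all `b, γ > 0` with
`max(γ, γ⁻¹, b, b⁻¹) ≤ M`, all `t > 0`, all `x ≥ 0`, and all `0 < p < b/γ`:
`∫_0^∞ y^{−p} q_t^{b,γ}(x,y) y^{b/γ−1} dy ≤ c (p/((b/γ)−p) + 1) (x+t)^{−p}`. -/
theorem qdens_negative_moment_bound (M : ℝ) (hM : 1 ≤ M) :
    ∃ c : ℝ, 0 < c ∧ ∀ b γ t x p : ℝ, 0 < b → 0 < γ →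
      max (max γ γ⁻¹) (max b b⁻¹) ≤ M → 0 < t → 0 ≤ x → 0 < p → p < b / γ →
      (∫ y in Set.Ioi (0 : ℝ), y ^ (-p) * qdens b γ t x y * y ^ (b / γ - 1))
        ≤ c * (p / (b / γ - p) + 1) * (x + t) ^ (-p) := by
  have hM0 : 0 < M := by linarith
  obtain ⟨k, hk⟩ := exists_nat_ge (M * M)
  refine ⟨(1 + M * M) * (1 + 2 ^ k + 2 ^ k * k.factorial) * M ^ k, by positivity, ?_⟩
  intro b γ t x p hb hγ hmax ht hx hp hpb
  have hγM : γ⁻¹ ≤ M := (le_max_right _ _).trans ((le_max_left _ _).trans hmax)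
  have hbM : b ≤ M := (le_max_left _ _).trans ((le_max_right _ _).trans hmax)
  have haM : b / γ ≤ M * M := by rw [div_eq_mul_inv]; gcongr
  have hpk : p ≤ k := by linarith
  have hq : 0 < b / γ - p := by linarith
  refine (integral_rpow_neg_mul_qdens_le k hγ ht hx hp hpb hpk).trans ?_
  have hMγ : 1 ≤ M * γ := by
    have h := mul_le_mul_of_nonneg_right hγM hγ.le
    rwa [inv_mul_cancel₀ hγ.ne'] at h
  have hbase : x + t ≤ M * (x + γ * t) := by
    nlinarith [mul_nonneg (sub_nonneg.2 hM) hx, mul_nonneg (sub_nonneg.2 hMγ) ht.le]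
  have hpos : 0 < x + γ * t := by positivity
  have hcompare : (x + γ * t) ^ (-p) ≤ M ^ k * (x + t) ^ (-p) := by
    have h1 : (M * (x + γ * t)) ^ (-p) ≤ (x + t) ^ (-p) :=
      Real.rpow_le_rpow_of_nonpos (by positivity) hbase (by linarith)
    have h2 : M ^ p ≤ M ^ k := by
      rw [← Real.rpow_natCast]
      exact Real.rpow_le_rpow_of_exponent_le hM hpk
    calc (x + γ * t) ^ (-p) = M ^ p * (M * (x + γ * t)) ^ (-p) := by
          rw [Real.mul_rpow hM0.le hpos.le, ← mul_assoc, ← Real.rpow_add hM0, add_neg_cancel,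
            Real.rpow_zero, one_mul]
      _ ≤ M ^ k * (x + t) ^ (-p) := by gcongr
  calc _ ≤ (p / (b / γ - p) + 1) * (1 + M * M) * (1 + 2 ^ k + 2 ^ k * k.factorial) *
        (M ^ k * (x + t) ^ (-p)) := by gcongr
    _ = _ := by ring
end

section
/- For every M ≥ 1 there is a constant c = c(M) such that for all b, γ > 0 with max(γ, γ^{-1}, b, b^{-1}) ≤ M and all t > 0: sup_{y ≥ 0} | ∫_0^∞ (x − y) x^{b/γ} (∂²/∂x²) q_t^{b,γ}(x,y) dx | ≤ c, where the integral is with respect to Lebesgue measure dx. -/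
open MeasureTheory

/-- The entire function `z ↦ ∑ zᵐ / (m! Γ(m + μ))`, a rescaled modified Bessel function. -/
noncomputable def besselSeries (μ z : ℝ) : ℝ :=
  ∑' m : ℕ, z ^ m / ((m.factorial : ℝ) * Real.Gamma (m + μ))

lemma Gamma_nat_add_pos {μ : ℝ} (hμ : 0 < μ) (m : ℕ) : 0 < Real.Gamma (m + μ) :=
  Real.Gamma_pos_of_pos (by positivity)

lemma exists_Gamma_nat_add_lower_bound {μ : ℝ} (hμ : 0 < μ) :
    ∃ c : ℝ, 0 < c ∧ ∀ m : ℕ, c ≤ Real.Gamma (m + μ) := by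
  have h₁ : ∀ m : ℕ, Real.Gamma (μ + 1) ≤ Real.Gamma ((m + 1 : ℕ) + μ) := by
    intro m
    induction m with
    | zero => simp [add_comm]
    | succ m ih =>
      have hrec : Real.Gamma ((m + 1 + 1 : ℕ) + μ)
          = ((m + 1 : ℕ) + μ) * Real.Gamma ((m + 1 : ℕ) + μ) := by
        rw [← Real.Gamma_add_one (by positivity)]
        push_cast
        ring_nf
      have hpos := Gamma_nat_add_pos hμ (m + 1)
      have hone : (1 : ℝ) ≤ (m + 1 : ℕ) + μ := by
        push_cast
        linarith [(Nat.cast_nonneg m : (0 : ℝ) ≤ m)]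
      rw [hrec]
      nlinarith
  refine ⟨min (Real.Gamma μ) (Real.Gamma (μ + 1)),
    lt_min (Real.Gamma_pos_of_pos hμ) (Real.Gamma_pos_of_pos (by linarith)), fun m => ?_⟩
  cases m with
  | zero => simp
  | succ m => exact (min_le_right _ _).trans (h₁ m)

lemma summable_besselSeries {μ : ℝ} (hμ : 0 < μ) (z : ℝ) :
    Summable fun m : ℕ => z ^ m / ((m.factorial : ℝ) * Real.Gamma (m + μ)) := by
  obtain ⟨c, hc, hle⟩ := exists_Gamma_nat_add_lower_bound hμ
  refine Summable.of_norm_bounded ((Real.summable_pow_div_factorial |z|).mul_left c⁻¹)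
    fun m => ?_
  have hΓ := Gamma_nat_add_pos hμ m
  rw [norm_div, norm_pow, Real.norm_eq_abs, Real.norm_eq_abs, abs_of_pos (show 0 < (m.factorial : ℝ) * Real.Gamma (m + μ) by positivity),
    ← div_eq_inv_mul, div_div]
  gcongr
  exact hle m

lemma hasDerivAt_besselSeries {μ : ℝ} (hμ : 0 < μ) (z : ℝ) :
    HasDerivAt (besselSeries μ) (besselSeries (μ + 1) z) z := by
  obtain ⟨c, hc, hle⟩ := exists_Gamma_nat_add_lower_bound hμ
  set R : ℝ := |z| + 1
  have hR : 0 < R := by positivity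
  have hu : Summable fun m : ℕ => c⁻¹ * (m * R ^ (m - 1) / (m.factorial : ℝ)) := by
    refine Summable.mul_left _
      ((summable_nat_add_iff (f := fun m : ℕ => m * R ^ (m - 1) / (m.factorial : ℝ)) 1).mp ?_)
    refine (Real.summable_pow_div_factorial R).congr fun m => ?_
    rw [Nat.factorial_succ, Nat.add_sub_cancel]
    push_cast
    field_simp
  have h := hasDerivAt_tsum_of_isPreconnected (y := z) (y₀ := 0) (t := Metric.ball (0 : ℝ) R)
    (g := fun (m : ℕ) z => z ^ m / ((m.factorial : ℝ) * Real.Gamma (m + μ)))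
    (g' := fun (m : ℕ) z => m * z ^ (m - 1) / ((m.factorial : ℝ) * Real.Gamma (m + μ)))
    hu Metric.isOpen_ball (convex_ball _ _).isPreconnected
    (fun m y _ => (hasDerivAt_pow m y).div_const _)
    (fun m y hy => by
      have hΓ := Gamma_nat_add_pos hμ m
      have hy' : |y| ≤ R := by simpa using (Metric.mem_ball.mp hy).le
      rw [norm_div, norm_mul, norm_pow, Real.norm_eq_abs, Real.norm_eq_abs, Real.norm_eq_abs,
        abs_of_pos (show 0 < (m.factorial : ℝ) * Real.Gamma (m + μ) by positivity),
        abs_of_nonneg (Nat.cast_nonneg m), ← div_eq_inv_mul, div_div]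
      gcongr
      exact hle m)
    (Metric.mem_ball_self hR) (summable_besselSeries hμ 0) (by simp [R])
  refine h.congr_deriv ?_
  have hs : Summable fun m : ℕ =>
      (m + 1 : ℕ) * z ^ m / (((m + 1).factorial : ℝ) * Real.Gamma ((m + 1 : ℕ) + μ)) := by
    refine (summable_besselSeries (μ := μ + 1) (by linarith) z).congr fun m => ?_
    rw [Nat.factorial_succ]
    push_cast
    rw [add_right_comm, ← add_assoc]
    field_simp
  rw [((summable_nat_add_iff
    (f := fun m : ℕ => m * z ^ (m - 1) / ((m.factorial : ℝ) * Real.Gamma (m + μ))) 1).mp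
    hs).tsum_eq_zero_add]
  simp only [Nat.cast_zero, zero_mul, zero_div, zero_add, besselSeries, Nat.add_sub_cancel]
  refine tsum_congr fun m => ?_
  rw [Nat.factorial_succ]
  push_cast
  rw [add_right_comm, ← add_assoc]
  field_simp

lemma integral_rpow_mul_exp_mul_besselSeries {a μ w S : ℝ} (ha : -1 < a) (hμ : 0 < μ)
    (hw : 0 ≤ w)
    (hS : HasSum (fun m : ℕ => Real.Gamma (m + a + 1) / Real.Gamma (m + μ) *
      (w ^ m / (m.factorial : ℝ))) S) :
    IntegrableOn (fun u => u ^ a * Real.exp (-u) * besselSeries μ (u * w)) (Set.Ioi 0) ∧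
      ∫ u in Set.Ioi 0, u ^ a * Real.exp (-u) * besselSeries μ (u * w) = S := by
  set F : ℕ → ℝ → ℝ := fun m u => Real.exp (-u) * u ^ ((m + a + 1 : ℝ) - 1) *
    (w ^ m / ((m.factorial : ℝ) * Real.Gamma (m + μ))) with hF
  have hpos : ∀ m : ℕ, (0 : ℝ) < m + a + 1 := fun m => by
    linarith [(Nat.cast_nonneg m : (0 : ℝ) ≤ m)]
  have hint : ∀ m, Integrable (F m) (volume.restrict (Set.Ioi 0)) := fun m =>
    (Real.GammaIntegral_convergent (hpos m)).mul_const _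
  have hval : ∀ m, ∫ u in Set.Ioi 0, F m u = Real.Gamma (m + a + 1) / Real.Gamma (m + μ) *
      (w ^ m / (m.factorial : ℝ)) := fun m => by
    have hΓ := Gamma_nat_add_pos hμ m
    rw [hF, integral_mul_const, ← Real.Gamma_eq_integral (hpos m)]
    field_simp
  have hnorm : ∀ m, ∫ u in Set.Ioi 0, ‖F m u‖ = ∫ u in Set.Ioi 0, F m u := fun m => by
    refine setIntegral_congr_fun measurableSet_Ioi fun u hu => ?_
    have hΓ := Gamma_nat_add_pos hμ m
    have hu' : (0 : ℝ) < u := hu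
    exact Real.norm_of_nonneg (by positivity)
  have hsum := hasSum_integral_of_summable_integral_norm hint
    (hS.summable.congr fun m => by rw [hnorm, hval])
  simp only [hval] at hsum
  have heq : ∫ u in Set.Ioi 0, u ^ a * Real.exp (-u) * besselSeries μ (u * w) = S := by
    rw [← hsum.unique hS]
    refine setIntegral_congr_fun measurableSet_Ioi fun u hu => ?_
    have hu' : (0 : ℝ) < u := hu
    simp only [besselSeries, hF, ← tsum_mul_left]
    refine tsum_congr fun m => ?_
    rw [show (m + a + 1 : ℝ) - 1 = a + m by ring, Real.rpow_add_natCast hu'.ne', mul_pow]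
    ring
  have hterm : ∀ m : ℕ, 0 ≤ Real.Gamma (m + a + 1) / Real.Gamma (m + μ) *
      (w ^ m / (m.factorial : ℝ)) := fun m => by
    have h₁ := Real.Gamma_pos_of_pos (hpos m)
    have h₂ := Gamma_nat_add_pos hμ m
    positivity
  have hSpos : 0 < S := by
    refine lt_of_lt_of_le ?_ (le_hasSum hS 0 fun m _ => hterm m)
    have h₁ := Real.Gamma_pos_of_pos (hpos 0)
    have h₂ := Gamma_nat_add_pos hμ 0
    simp only [pow_zero, Nat.factorial_zero, Nat.cast_one, div_one, mul_one]
    positivity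
  exact ⟨Integrable.of_integral_ne_zero (by rw [heq]; exact hSpos.ne'), heq⟩

lemma hasSum_pow_div_factorial (w : ℝ) :
    HasSum (fun m : ℕ => w ^ m / (m.factorial : ℝ)) (Real.exp w) := by
  rw [Real.exp_eq_exp_ℝ]
  exact NormedSpace.expSeries_div_hasSum_exp w

/-- Index shift: multiplying a factorial series by `w` multiplies the shifted coefficients
by `m`. -/
lemma HasSum.nat_mul_shift {f g : ℕ → ℝ} {w S : ℝ}
    (hf : HasSum (fun m : ℕ => f m * (w ^ m / (m.factorial : ℝ))) S)
    (hg : ∀ m : ℕ, g (m + 1) = (m + 1) * f m) (hg₀ : g 0 = 0) :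
    HasSum (fun m : ℕ => g m * (w ^ m / (m.factorial : ℝ))) (w * S) := by
  have h : HasSum (fun m : ℕ => g (m + 1) * (w ^ (m + 1) / ((m + 1).factorial : ℝ))) (w * S) := by
    refine (hf.mul_left w).congr_fun fun m => ?_
    rw [hg, Nat.factorial_succ, pow_succ]
    push_cast
    field_simp
  simpa [hg₀] using (hasSum_nat_add_iff (f := fun m : ℕ => g m * (w ^ m / (m.factorial : ℝ))) 1).mp h

lemma exists_hasSum_div_nat_add {μ : ℝ} (hμ : 0 < μ) (w : ℝ) :
    ∃ S, HasSum (fun m : ℕ => 1 / (m + μ) * (w ^ m / (m.factorial : ℝ))) S := by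
  refine ⟨_, Summable.hasSum (Summable.of_norm_bounded
    ((Real.summable_pow_div_factorial |w|).mul_left (1 / μ)) fun m => ?_)⟩
  have hm : (0 : ℝ) < m + μ := by positivity
  rw [norm_mul, norm_div, norm_div, norm_pow, Real.norm_eq_abs w,
    Real.norm_of_nonneg (Nat.cast_nonneg m.factorial), norm_one, Real.norm_of_nonneg hm.le]
  gcongr
  linarith [(Nat.cast_nonneg m : (0 : ℝ) ≤ m)]

lemma abs_series_remainder_le {ν w S : ℝ} (hν : 0 < ν) (hw : 0 ≤ w)
    (hS : HasSum (fun m : ℕ => 1 / (m + (ν + 1)) * (w ^ m / (m.factorial : ℝ))) S) :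
    |w ^ 3 * S - w ^ 2 * Real.exp w + ν * w * Real.exp w|
      ≤ (ν + 1) * (ν + 2) * Real.exp w := by
  obtain ⟨E, hE⟩ := exists_hasSum_div_nat_add hν w
  have hexp := hasSum_pow_div_factorial w
  have hcast : ∀ m : ℕ, (0 : ℝ) ≤ m := fun m => Nat.cast_nonneg m
  have hwS : w * S = Real.exp w - ν * E := by
    refine (hS.nat_mul_shift (g := fun m => m / (m + ν)) (fun m => ?_) (by simp)).unique
      ((hexp.sub (hE.mul_left ν)).congr_fun fun m => ?_)
    · push_cast
      field_simp
      ring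
    · have : (m : ℝ) + ν ≠ 0 := by positivity
      field_simp
      ring
  have hP := hE.sub hS
  have hP₀ : 0 ≤ E - S := by
    refine hP.nonneg fun m => ?_
    rw [← sub_mul]
    refine mul_nonneg (sub_nonneg.mpr ?_) (by positivity)
    gcongr
    linarith
  have hνE : ν * (w * E) ≤ (ν + 1) * Real.exp w := by
    have h := (hE.nat_mul_shift (g := fun m => m / (m - 1 + ν)) (fun m => by
      push_cast
      ring) (by simp)).mul_left ν
    refine hasSum_le (fun m => ?_) h (hexp.mul_left (ν + 1))
    rw [← mul_assoc]
    refine mul_le_mul_of_nonneg_right ?_ (by positivity)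
    cases m with
    | zero => simp; linarith
    | succ m =>
      have : (0 : ℝ) < m + ν := by positivity
      push_cast
      rw [add_sub_cancel_right, mul_div_assoc', div_le_iff₀ this]
      nlinarith [hcast m, mul_nonneg hν.le (hcast m)]
  have hνP : ν * (w * (w * (E - S))) ≤ 2 * (ν + 1) * Real.exp w := by
    have hP' : HasSum (fun m : ℕ => 1 / ((m + ν) * (m + ν + 1)) * (w ^ m / (m.factorial : ℝ)))
        (E - S) := by
      refine hP.congr_fun fun m => ?_
      have : (m : ℝ) + ν ≠ 0 := by positivity
      have : (m : ℝ) + ν + 1 ≠ 0 := by positivity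
      have : (m : ℝ) + (ν + 1) ≠ 0 := by positivity
      field_simp
      ring
    have h := ((hP'.nat_mul_shift (g := fun m => m / ((m - 1 + ν) * (m + ν))) (fun m => by
      push_cast
      ring) (by simp)).nat_mul_shift
        (g := fun m => m * (m - 1) / ((m - 2 + ν) * (m - 1 + ν))) (fun m => by
          push_cast
          ring) (by simp)).mul_left ν
    refine hasSum_le (fun m => ?_) h (hexp.mul_left (2 * (ν + 1)))
    rw [← mul_assoc]
    refine mul_le_mul_of_nonneg_right ?_ (by positivity)
    rcases m with _ | _ | m
    · simp; linarith
    · simp; linarith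
    · have : (0 : ℝ) < (m + ν) * (m + ν + 1) := by positivity
      push_cast
      rw [show ((m : ℝ) + 1 + 1 - 2 + ν) * (m + 1 + 1 - 1 + ν) = (m + ν) * (m + ν + 1) by ring,
        mul_div_assoc', div_le_iff₀ this]
      have h₁ : ν * (m + 1) ≤ (ν + 1) * (m + ν) := by
        nlinarith [hcast m, mul_nonneg hν.le (hcast m)]
      have h₂ : (m + 2 : ℝ) ≤ 2 * (m + ν + 1) := by linarith [hcast m]
      have h₃ := mul_le_mul h₁ h₂ (by positivity) (by positivity)
      linarith
  have hE₀ : 0 ≤ E := hE.nonneg fun m => by positivity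
  have hkey : w ^ 3 * S - w ^ 2 * Real.exp w + ν * w * Real.exp w
      = ν * (ν * (w * E)) - ν * (w * (w * (E - S))) := by
    linear_combination (w ^ 2 - ν * w) * hwS
  have h₁ : 0 ≤ ν * (w * E) := by positivity
  have h₂ : 0 ≤ ν * (w * (w * (E - S))) := by positivity
  have hexp₀ := Real.exp_pos w
  rw [hkey, abs_le]
  constructor <;> nlinarith

lemma qdens_eq_besselSeries (b γ t x y : ℝ) :
    qdens b γ t x y = (γ * t) ^ (-(b / γ)) * (Real.exp (-(x + y) / (γ * t)) *
      besselSeries (b / γ) (x / (γ * t) * (y / (γ * t)))) := by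
  rw [qdens, besselSeries, mul_assoc]
  congr 2
  refine tsum_congr fun m => ?_
  rw [mul_pow]
  ring

lemma hasDerivAt_exp_mul_besselSeries {μ : ℝ} (hμ : 0 < μ) (s y w x : ℝ) :
    HasDerivAt (fun x => Real.exp (-(x + y) / s) * besselSeries μ (x / s * w))
      (s⁻¹ * (w * (Real.exp (-(x + y) / s) * besselSeries (μ + 1) (x / s * w)) -
        Real.exp (-(x + y) / s) * besselSeries μ (x / s * w))) x := by
  have h₁ : HasDerivAt (fun x => -(x + y) / s) (-1 / s) x :=
    (((hasDerivAt_id x).add_const y).neg).div_const s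
  have h₂ : HasDerivAt (fun x => x / s * w) (1 / s * w) x :=
    ((hasDerivAt_id x).div_const s).mul_const w
  refine (h₁.exp.mul ((hasDerivAt_besselSeries hμ _).comp x h₂)).congr_deriv ?_
  simp only [Function.comp_apply]
  ring

lemma iteratedDeriv_two_qdens {b γ : ℝ} (hν : 0 < b / γ) (t x y : ℝ) :
    iteratedDeriv 2 (fun x' => qdens b γ t x' y) x =
      (γ * t) ^ (-(b / γ)) * ((γ * t)⁻¹ ^ 2 * (Real.exp (-(x + y) / (γ * t)) *
        ((y / (γ * t)) ^ 2 * besselSeries (b / γ + 1 + 1) (x / (γ * t) * (y / (γ * t)))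
          - 2 * (y / (γ * t)) * besselSeries (b / γ + 1) (x / (γ * t) * (y / (γ * t)))
          + besselSeries (b / γ) (x / (γ * t) * (y / (γ * t)))))) := by
  simp only [qdens_eq_besselSeries]
  set s := γ * t
  set w := y / s
  set ν := b / γ
  rw [iteratedDeriv_succ, iteratedDeriv_one]
  have hd : deriv (fun x => s ^ (-ν) * (Real.exp (-(x + y) / s) * besselSeries ν (x / s * w)))
      = fun x => s ^ (-ν) * (s⁻¹ * (w * (Real.exp (-(x + y) / s) *
        besselSeries (ν + 1) (x / s * w)) - Real.exp (-(x + y) / s) *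
          besselSeries ν (x / s * w))) :=
    funext fun x => ((hasDerivAt_exp_mul_besselSeries hν s y w x).const_mul _).deriv
  rw [hd]
  have h₀ := hasDerivAt_exp_mul_besselSeries hν s y w x
  have h₁ := hasDerivAt_exp_mul_besselSeries (show 0 < ν + 1 by linarith) s y w x
  refine ((((h₁.const_mul w).sub h₀).const_mul s⁻¹).const_mul (s ^ (-ν))).deriv.trans ?_
  ring

lemma Gamma_nat_add_add_one {μ : ℝ} (hμ : 0 < μ) (m : ℕ) :
    Real.Gamma (m + μ + 1) = (m + μ) * Real.Gamma (m + μ) :=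
  Real.Gamma_add_one (by positivity)

/-- The second-derivative integral in the scaled variables `u = x / (γ t)`, `w = y / (γ t)`. -/
lemma abs_scaled_integral_le {ν w : ℝ} (hν : 0 < ν) (hw : 0 ≤ w) :
    |∫ u in Set.Ioi (0 : ℝ), (u - w) * u ^ ν * (Real.exp (-u) *
      (w ^ 2 * besselSeries (ν + 1 + 1) (u * w) - 2 * w * besselSeries (ν + 1) (u * w)
        + besselSeries ν (u * w)))|
      ≤ (ν * (ν + 1) + (ν + 1) * (ν + 2)) * Real.exp w := by
  have hν₁ : 0 < ν + 1 := by linarith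
  have hν₂ : 0 < ν + 1 + 1 := by linarith
  have hΓ₀ := Gamma_nat_add_pos hν
  have hΓ₁ := Gamma_nat_add_pos hν₁
  have hΓ₂ := Gamma_nat_add_pos hν₂
  have hrec₁ : ∀ m : ℕ, Real.Gamma (m + (ν + 1)) = (m + ν) * Real.Gamma (m + ν) := fun m => by
    rw [← Gamma_nat_add_add_one hν, add_assoc]
  have hrec₂ : ∀ m : ℕ,
      Real.Gamma (m + (ν + 1 + 1)) = (m + (ν + 1)) * Real.Gamma (m + (ν + 1)) := fun m => by
    rw [← Gamma_nat_add_add_one hν₁, ← add_assoc (m : ℝ) (ν + 1) 1]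
  have hexp := hasSum_pow_div_factorial w
  have hexp₁ : HasSum (fun m : ℕ => (m : ℝ) * (w ^ m / (m.factorial : ℝ))) (w * Real.exp w) :=
    HasSum.nat_mul_shift (f := fun _ => 1) (g := fun m => m) (by simpa using hexp)
      (fun m => by simp) (by simp)
  have hexp₂ : HasSum (fun m : ℕ => (m * (m - 1) : ℝ) * (w ^ m / (m.factorial : ℝ)))
      (w * (w * Real.exp w)) :=
    HasSum.nat_mul_shift (f := fun m => m) (g := fun m => m * (m - 1)) hexp₁
      (fun m => by simp) (by simp)
  obtain ⟨S, hS⟩ := exists_hasSum_div_nat_add hν₁ w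
  have ha₀ : -1 < ν := by linarith
  have ha₁ : -1 < ν + 1 := by linarith
  obtain ⟨i₀₀, e₀₀⟩ := integral_rpow_mul_exp_mul_besselSeries (S := w * Real.exp w + ν * Real.exp w)
    ha₀ hν hw ((hexp₁.add (hexp.mul_left ν)).congr_fun fun m => by
      have := (hΓ₀ m).ne'
      rw [add_assoc, hrec₁]
      field_simp)
  obtain ⟨i₀₁, e₀₁⟩ := integral_rpow_mul_exp_mul_besselSeries (S := Real.exp w)
    ha₀ hν₁ hw (hexp.congr_fun fun m => by
      have := (hΓ₁ m).ne'
      rw [add_assoc]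
      field_simp)
  obtain ⟨i₀₂, e₀₂⟩ := integral_rpow_mul_exp_mul_besselSeries (S := S)
    ha₀ hν₂ hw (hS.congr_fun fun m => by
      have := (hΓ₁ m).ne'
      rw [add_assoc, hrec₂]
      field_simp)
  obtain ⟨i₁₀, e₁₀⟩ := integral_rpow_mul_exp_mul_besselSeries
    (S := w * (w * Real.exp w) + (2 * (ν + 1)) * (w * Real.exp w) + (ν * (ν + 1)) * Real.exp w)
    ha₁ hν hw (((hexp₂.add (hexp₁.mul_left _)).add (hexp.mul_left _)).congr_fun fun m => by
      have := (hΓ₀ m).ne'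
      rw [add_assoc, hrec₂, hrec₁]
      field_simp
      ring)
  obtain ⟨i₁₁, e₁₁⟩ := integral_rpow_mul_exp_mul_besselSeries
    (S := w * Real.exp w + (ν + 1) * Real.exp w)
    ha₁ hν₁ hw ((hexp₁.add (hexp.mul_left _)).congr_fun fun m => by
      have := (hΓ₁ m).ne'
      rw [add_assoc, hrec₂]
      field_simp)
  obtain ⟨i₁₂, e₁₂⟩ := integral_rpow_mul_exp_mul_besselSeries (S := Real.exp w)
    ha₁ hν₂ hw (hexp.congr_fun fun m => by
      have := (hΓ₂ m).ne'
      rw [add_assoc]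
      field_simp)
  have hval : ∫ u in Set.Ioi (0 : ℝ), (u - w) * u ^ ν * (Real.exp (-u) *
      (w ^ 2 * besselSeries (ν + 1 + 1) (u * w) - 2 * w * besselSeries (ν + 1) (u * w)
        + besselSeries ν (u * w)))
      = ν * (ν + 1) * Real.exp w
        - (w ^ 3 * S - w ^ 2 * Real.exp w + ν * w * Real.exp w) := by
    have hlin := integral_add'
      (((i₁₂.const_mul (w ^ 2)).sub (i₁₁.const_mul (2 * w))).add i₁₀)
      ((((i₀₂.const_mul (w ^ 3)).sub (i₀₁.const_mul (2 * w ^ 2))).add (i₀₀.const_mul w)).neg)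
    rw [integral_neg', integral_add' ((i₁₂.const_mul _).sub (i₁₁.const_mul _)) i₁₀,
      integral_sub' (i₁₂.const_mul _) (i₁₁.const_mul _),
      integral_add' ((i₀₂.const_mul _).sub (i₀₁.const_mul _)) (i₀₀.const_mul _),
      integral_sub' (i₀₂.const_mul _) (i₀₁.const_mul _)] at hlin
    simp only [Pi.add_apply, Pi.sub_apply, Pi.neg_apply] at hlin
    simp only [integral_const_mul, e₀₀, e₀₁, e₀₂, e₁₀, e₁₁, e₁₂] at hlin
    calc _ = _ := setIntegral_congr_fun measurableSet_Ioi fun u hu => ?_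
      _ = _ := hlin
      _ = _ := by ring
    simp only [Real.rpow_add_one (ne_of_gt (show (0 : ℝ) < u from hu))]
    ring
  have hrem := abs_le.mp (abs_series_remainder_le hν hw hS)
  have hpos : 0 ≤ ν * (ν + 1) * Real.exp w := by positivity
  rw [hval, abs_le]
  constructor <;> linarith [hrem.1, hrem.2]

lemma abs_integral_qdens_second_deriv_le {b γ t y : ℝ} (hb : 0 < b) (hγ : 0 < γ) (ht : 0 < t)
    (hy : 0 ≤ y) :
    |∫ x in Set.Ioi (0 : ℝ),
        (x - y) * x ^ (b / γ) * iteratedDeriv 2 (fun x' => qdens b γ t x' y) x|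
      ≤ b / γ * (b / γ + 1) + (b / γ + 1) * (b / γ + 2) := by
  have hν : 0 < b / γ := by positivity
  simp only [iteratedDeriv_two_qdens hν]
  have hs : 0 < γ * t := by positivity
  set s := γ * t
  set ν := b / γ
  have hw : 0 ≤ y / s := by positivity
  have hbound := abs_scaled_integral_le hν hw
  set w := y / s with hw_def
  set h : ℝ → ℝ := fun u => (u - w) * u ^ ν * (Real.exp (-u) *
      (w ^ 2 * besselSeries (ν + 1 + 1) (u * w) - 2 * w * besselSeries (ν + 1) (u * w)
        + besselSeries ν (u * w))) with hh
  have hscale : ∫ x in Set.Ioi (0 : ℝ), (x - y) * x ^ ν * (s ^ (-ν) * (s⁻¹ ^ 2 *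
      (Real.exp (-(x + y) / s) * (w ^ 2 * besselSeries (ν + 1 + 1) (x / s * w)
        - 2 * w * besselSeries (ν + 1) (x / s * w) + besselSeries ν (x / s * w)))))
      = Real.exp (-w) * ∫ u in Set.Ioi (0 : ℝ), h u := by
    have hsub := integral_comp_mul_left_Ioi h 0 (inv_pos.mpr hs)
    rw [mul_zero, inv_inv, smul_eq_mul] at hsub
    have hsub' : ∫ u in Set.Ioi (0 : ℝ), h u = s⁻¹ * ∫ x in Set.Ioi (0 : ℝ), h (s⁻¹ * x) := by
      rw [hsub, inv_mul_cancel_left₀ hs.ne']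
    rw [hsub', ← integral_const_mul, ← integral_const_mul]
    refine setIntegral_congr_fun measurableSet_Ioi fun x hx => ?_
    have hx' : (0 : ℝ) < x := hx
    have hexp : Real.exp (-(x + y) / s) = Real.exp (-w) * Real.exp (-(x / s)) := by
      rw [← Real.exp_add, hw_def]
      ring_nf
    have hpow : (x / s) ^ ν = x ^ ν * s ^ (-ν) := by
      rw [Real.div_rpow hx'.le hs.le, Real.rpow_neg hs.le, div_eq_mul_inv]
    have hsubw : x - y = s * (x / s - w) := by
      rw [hw_def]
      field_simp
    simp only [hh, ← div_eq_inv_mul]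
    rw [hexp, hpow, hsubw]
    field_simp
  rw [hscale, abs_mul, abs_of_pos (Real.exp_pos _), Real.exp_neg, ← div_eq_inv_mul,
    div_le_iff₀ (Real.exp_pos w)]
  exact hbound

/-- For every `M ≥ 1` there is a constant `c = c(M)` such that for all `b, γ > 0` with
`max(γ, γ⁻¹, b, b⁻¹) ≤ M` and all `t > 0`:
`sup_{y ≥ 0} | ∫_0^∞ (x − y) x^{b/γ} ∂²_x q_t^{b,γ}(x,y) dx | ≤ c`. -/
theorem qdens_second_deriv_integral_bound (M : ℝ) (hM : 1 ≤ M) :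
    ∃ c : ℝ, 0 < c ∧ ∀ b γ t : ℝ, 0 < b → 0 < γ →
      max (max γ γ⁻¹) (max b b⁻¹) ≤ M → 0 < t → ∀ y : ℝ, 0 ≤ y →
      |∫ x in Set.Ioi (0 : ℝ),
          (x - y) * x ^ (b / γ) * iteratedDeriv 2 (fun x' => qdens b γ t x' y) x|
        ≤ c := by
  have hM₀ : 0 < M := by linarith
  refine ⟨M * M * (M * M + 1) + (M * M + 1) * (M * M + 2), by positivity, ?_⟩
  intro b γ t hb hγ hmax ht y hy
  simp only [max_le_iff] at hmax
  have hν : b / γ ≤ M * M := by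
    rw [div_eq_mul_inv]
    exact mul_le_mul hmax.2.1 hmax.1.2 (by positivity) hM₀.le
  refine (abs_integral_qdens_second_deriv_le hb hγ ht hy).trans ?_
  have hν₀ : 0 < b / γ := by positivity
  gcongr
end

section
/- For every M ≥ 1 there is a constant c = c(M) such that for all b, γ > 0 with max(γ, γ^{-1}, b, b^{-1}) ≤ M, all t > 0 and all y ≥ 0, and for D̃ equal to either the first derivative operator z ↦ ∂_z or the operator z ↦ z ∂²_z acting on the z-variable: | ∫_0^∞ (D̃_z q_t^{b,γ})(z,y) z^{b/γ − 1} dz | ≤ c (t + y)^{-1}. -/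
open MeasureTheory

/-- The coefficients `c` define an everywhere absolutely convergent power series. -/
def EntireCoeff (c : ℕ → ℝ) : Prop :=
  ∀ r : ℝ, 0 ≤ r → Summable fun m : ℕ => |c m| * r ^ m

/-- The function `u ↦ e^{-u} ∑ c_m u^m`. -/
noncomputable def expNegSeries (c : ℕ → ℝ) (u : ℝ) : ℝ :=
  Real.exp (-u) * ∑' m : ℕ, c m * u ^ m

/-- The coefficients of the derivative of `expNegSeries c`. -/
def derivCoeff (c : ℕ → ℝ) (m : ℕ) : ℝ := ((m : ℝ) + 1) * c (m + 1) - c m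

lemma EntireCoeff.summable {c : ℕ → ℝ} (hc : EntireCoeff c) (u : ℝ) :
    Summable fun m : ℕ => c m * u ^ m := by
  refine Summable.of_norm ((hc |u| (abs_nonneg u)).congr fun m => ?_)
  simp

lemma EntireCoeff.summable_natCast_mul {c : ℕ → ℝ} (hc : EntireCoeff c) {r : ℝ} (hr : 0 ≤ r) :
    Summable fun m : ℕ => |c m| * (m * r ^ (m - 1)) := by
  refine Summable.of_nonneg_of_le (fun m => by positivity) (fun m => ?_)
    (hc (2 * (r + 1)) (by positivity))
  have h1 : (m : ℝ) ≤ 2 ^ m := by exact_mod_cast Nat.lt_two_pow_self.le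
  have h2 : r ^ (m - 1) ≤ (r + 1) ^ m :=
    calc r ^ (m - 1) ≤ (r + 1) ^ (m - 1) := by gcongr; linarith
      _ ≤ (r + 1) ^ m := pow_le_pow_right₀ (by linarith) (Nat.sub_le _ _)
  rw [mul_pow]
  gcongr

lemma EntireCoeff.derivCoeff {c : ℕ → ℝ} (hc : EntireCoeff c) : EntireCoeff (derivCoeff c) := by
  intro r hr
  have h := (summable_nat_add_iff 1).2 (hc.summable_natCast_mul hr)
  refine Summable.of_nonneg_of_le (fun m => by positivity) (fun m => ?_) (h.add (hc r hr))
  have h1 : |_root_.derivCoeff c m| ≤ |c (m + 1)| * (m + 1) + |c m| := by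
    refine (abs_sub _ _).trans_eq ?_
    rw [abs_mul, abs_of_nonneg (by positivity : (0 : ℝ) ≤ m + 1), mul_comm]
  calc |_root_.derivCoeff c m| * r ^ m ≤ (|c (m + 1)| * (m + 1) + |c m|) * r ^ m := by gcongr
    _ = _ := by simp only [Nat.add_sub_cancel]; push_cast; ring

lemma hasDerivAt_tsum_pow {c : ℕ → ℝ} (hc : EntireCoeff c) (u : ℝ) :
    HasDerivAt (fun v => ∑' m : ℕ, c m * v ^ m) (∑' m : ℕ, ((m : ℝ) + 1) * c (m + 1) * u ^ m) u := by
  have hR : 0 ≤ |u| + 1 := by positivity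
  have hs := hc.summable_natCast_mul hR
  have hbound : ∀ (n : ℕ), ∀ v ∈ Metric.ball (0 : ℝ) (|u| + 1),
      ‖c n * (n * v ^ (n - 1))‖ ≤ |c n| * (n * (|u| + 1) ^ (n - 1)) := by
    intro n v hv
    have hv' : |v| ≤ |u| + 1 := by simpa using (mem_ball_zero_iff.1 hv).le
    rw [Real.norm_eq_abs, abs_mul, abs_mul, abs_pow, Nat.abs_cast]
    gcongr
  have hu : u ∈ Metric.ball (0 : ℝ) (|u| + 1) := by simp
  have h := hasDerivAt_tsum_of_isPreconnected hs Metric.isOpen_ball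
    (convex_ball (0 : ℝ) (|u| + 1)).isPreconnected
    (fun n v _ => (hasDerivAt_pow n v).const_mul (c n)) hbound hu (hc.summable u) hu
  refine h.congr_deriv ?_
  have hsum : Summable fun n : ℕ => c n * (n * u ^ (n - 1)) :=
    Summable.of_norm_bounded hs fun n => hbound n u hu
  rw [hsum.tsum_eq_zero_add]
  simp only [CharP.cast_eq_zero, zero_mul, mul_zero, zero_add]
  refine tsum_congr fun m => ?_
  simp only [Nat.add_sub_cancel]
  push_cast
  ring

lemma hasDerivAt_expNegSeries {c : ℕ → ℝ} (hc : EntireCoeff c) (u : ℝ) :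
    HasDerivAt (expNegSeries c) (expNegSeries (derivCoeff c) u) u := by
  have h := ((hasDerivAt_neg u).exp).mul (hasDerivAt_tsum_pow hc u)
  refine h.congr_deriv ?_
  have hD := hc.derivCoeff.summable u
  have h1 : ∑' m : ℕ, ((m : ℝ) + 1) * c (m + 1) * u ^ m
      = (∑' m : ℕ, derivCoeff c m * u ^ m) + ∑' m : ℕ, c m * u ^ m := by
    rw [← hD.tsum_add (hc.summable u)]
    exact tsum_congr fun m => by simp only [derivCoeff]; ring
  rw [h1, expNegSeries]
  ring

lemma hasDerivAt_expNegSeries_div {c : ℕ → ℝ} (hc : EntireCoeff c) (K s z : ℝ) :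
    HasDerivAt (fun v => K * expNegSeries c (v / s))
      (K / s * expNegSeries (derivCoeff c) (z / s)) z := by
  have h := ((hasDerivAt_expNegSeries hc (z / s)).comp z ((hasDerivAt_id z).div_const s)).const_mul K
  refine h.congr_deriv ?_
  ring

lemma integral_expNegSeries_mul_rpow {c : ℕ → ℝ} {α : ℝ} (hα : 0 < α)
    (hc : Summable fun m : ℕ => c m * Real.Gamma (m + α)) :
    ∫ u in Set.Ioi (0 : ℝ), expNegSeries c u * u ^ (α - 1)
      = ∑' m : ℕ, c m * Real.Gamma (m + α) := by
  have hpos : ∀ m : ℕ, 0 < (m : ℝ) + α := fun m => by positivity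
  have h := hasSum_integral_of_summable_integral_norm
    (μ := volume.restrict (Set.Ioi (0 : ℝ)))
    (F := fun (m : ℕ) (u : ℝ) => c m * (Real.exp (-u) * u ^ ((m : ℝ) + α - 1)))
    (fun m => (Real.GammaIntegral_convergent (hpos m)).const_mul _) ?_
  · have h2 := h.tsum_eq
    simp only [integral_const_mul, ← Real.Gamma_eq_integral (hpos _)] at h2
    rw [h2]
    refine setIntegral_congr_fun measurableSet_Ioi fun u hu => ?_
    have hu : 0 < u := hu
    simp only [expNegSeries]
    rw [mul_assoc, ← tsum_mul_right, ← tsum_mul_left]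
    refine tsum_congr fun m => ?_
    rw [add_sub_assoc, Real.rpow_add hu, Real.rpow_natCast]
    ring
  · refine hc.abs.congr fun m => ?_
    rw [abs_mul, abs_of_pos (Real.Gamma_pos_of_pos (hpos m)), Real.Gamma_eq_integral (hpos m),
      ← integral_const_mul]
    refine setIntegral_congr_fun measurableSet_Ioi fun u hu => ?_
    have hu : 0 < u := hu
    simp only [norm_mul, Real.norm_eq_abs, Real.abs_exp, abs_of_pos (Real.rpow_pos_of_pos hu _)]

lemma integral_expNegSeries_div_mul_rpow {c : ℕ → ℝ} {α s : ℝ} (hα : 0 < α) (hs : 0 < s)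
    (hc : Summable fun m : ℕ => c m * Real.Gamma (m + α)) :
    ∫ z in Set.Ioi (0 : ℝ), expNegSeries c (z / s) * z ^ (α - 1)
      = s ^ α * ∑' m : ℕ, c m * Real.Gamma (m + α) := by
  have h := integral_comp_mul_left_Ioi (fun u => expNegSeries c u * u ^ (α - 1)) 0
    (inv_pos.2 hs)
  rw [mul_zero, integral_expNegSeries_mul_rpow hα hc, inv_inv, smul_eq_mul] at h
  calc ∫ z in Set.Ioi (0 : ℝ), expNegSeries c (z / s) * z ^ (α - 1)
      = ∫ z in Set.Ioi (0 : ℝ),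
          s ^ (α - 1) * (expNegSeries c (s⁻¹ * z) * (s⁻¹ * z) ^ (α - 1)) := by
        refine setIntegral_congr_fun measurableSet_Ioi fun z hz => ?_
        have hz : 0 < z := hz
        rw [Real.mul_rpow (by positivity) hz.le, Real.inv_rpow hs.le, inv_mul_eq_div]
        have := (Real.rpow_pos_of_pos hs (α - 1)).ne'
        field_simp
    _ = s ^ (α - 1) * s * ∑' m : ℕ, c m * Real.Gamma (m + α) := by
        rw [integral_const_mul, h, mul_assoc]
    _ = _ := by rw [← Real.rpow_add_one hs.ne', sub_add_cancel]

/-- The power series coefficients of the density, in the normalised variables. -/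
noncomputable def qCoeff (a w : ℝ) (m : ℕ) : ℝ :=
  1 / ((m.factorial : ℝ) * Real.Gamma ((m : ℝ) + a)) * w ^ m

/-- The moment sequence `(w^m / m!) (w / (m + a) - 1)`. -/
noncomputable def momentTerm (a w : ℝ) (m : ℕ) : ℝ :=
  w ^ m / (m.factorial : ℝ) * (w / (m + a) - 1)

lemma Gamma_inv_natCast_add_le {a : ℝ} (ha : 0 < a) (m : ℕ) :
    (Real.Gamma (m + a))⁻¹ ≤ (Real.Gamma a)⁻¹ + (Real.Gamma (1 + a))⁻¹ := by
  have h0 := Real.Gamma_pos_of_pos ha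
  have h1 := Real.Gamma_pos_of_pos (by positivity : 0 < 1 + a)
  have key : ∀ n : ℕ, Real.Gamma (1 + a) ≤ Real.Gamma ((n : ℝ) + 1 + a) := by
    intro n
    induction n with
    | zero => simp
    | succ k ih =>
      have hk : (0 : ℝ) < k + 1 + a := by positivity
      have e : ((k + 1 : ℕ) : ℝ) + 1 + a = (k + 1 + a) + 1 := by push_cast; ring
      rw [e, Real.Gamma_add_one hk.ne']
      nlinarith [Real.Gamma_pos_of_pos hk, (Nat.cast_nonneg k : (0 : ℝ) ≤ k)]
  cases m with
  | zero => simp [h1.le]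
  | succ k =>
    push_cast
    exact (inv_anti₀ h1 (key k)).trans (le_add_of_nonneg_left (by positivity))

lemma entireCoeff_qCoeff {a w : ℝ} (ha : 0 < a) (hw : 0 ≤ w) : EntireCoeff (qCoeff a w) := by
  intro r hr
  refine Summable.of_nonneg_of_le (fun m => by positivity) (fun m => ?_)
    ((Real.summable_pow_div_factorial (w * r)).mul_left
      ((Real.Gamma a)⁻¹ + (Real.Gamma (1 + a))⁻¹))
  have hG : 0 < Real.Gamma (m + a) := Real.Gamma_pos_of_pos (by positivity)
  have hq : 0 ≤ qCoeff a w m := by unfold qCoeff; positivity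
  calc |qCoeff a w m| * r ^ m
      = (Real.Gamma (m + a))⁻¹ * ((w * r) ^ m / (m.factorial : ℝ)) := by
        rw [abs_of_nonneg hq, qCoeff, mul_pow]; field_simp
    _ ≤ _ := by
        gcongr
        exact Gamma_inv_natCast_add_le ha m

lemma derivCoeff_qCoeff_mul_Gamma {a : ℝ} (ha : 0 < a) (w : ℝ) (m : ℕ) :
    derivCoeff (qCoeff a w) m * Real.Gamma (m + a) = momentTerm a w m := by
  have hma : 0 < (m : ℝ) + a := by positivity
  have hG := (Real.Gamma_pos_of_pos hma).ne'
  have hf : (m.factorial : ℝ) ≠ 0 := by positivity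
  have hm : (m : ℝ) + 1 ≠ 0 := by positivity
  have e : ((m + 1 : ℕ) : ℝ) + a = (m + a) + 1 := by push_cast; ring
  rw [derivCoeff, qCoeff, qCoeff, momentTerm, e, Real.Gamma_add_one hma.ne', Nat.factorial_succ]
  have := hma.ne'
  push_cast
  field_simp
  ring

lemma derivCoeff_derivCoeff_qCoeff_mul_Gamma {a : ℝ} (ha : 0 < a) (w : ℝ) (m : ℕ) :
    derivCoeff (derivCoeff (qCoeff a w)) m * Real.Gamma (m + (a + 1))
      = (((m + 1 : ℕ) : ℝ) * momentTerm a w (m + 1) - m * momentTerm a w m)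
        - a * momentTerm a w m := by
  have hma : 0 < (m : ℝ) + a := by positivity
  have e : ((m + 1 : ℕ) : ℝ) + a = (m + a) + 1 := by push_cast; ring
  rw [← derivCoeff_qCoeff_mul_Gamma ha, ← derivCoeff_qCoeff_mul_Gamma ha, e, ← add_assoc,
    Real.Gamma_add_one hma.ne', derivCoeff.eq_1 (derivCoeff (qCoeff a w)) m]
  push_cast
  ring

lemma abs_div_natCast_add_sub_one_le {a w : ℝ} (ha : 0 < a) (hw : 0 ≤ w) (m : ℕ) :
    |w / (m + a) - 1| ≤ w / a + 1 := by
  have h1 : 0 ≤ w / (m + a) := by positivity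
  have h2 : w / (m + a) ≤ w / a := by
    gcongr
    exact le_add_of_nonneg_left (by positivity)
  rw [abs_le]
  constructor <;> linarith

lemma summable_natCast_mul_momentTerm {a w : ℝ} (ha : 0 < a) (hw : 0 ≤ w) :
    Summable fun m : ℕ => (m : ℝ) * momentTerm a w m := by
  have h : Summable fun m : ℕ => (m : ℝ) * (w ^ m / (m.factorial : ℝ)) := by
    refine (summable_nat_add_iff 1).1 (((Real.summable_pow_div_factorial w).mul_left w).congr
      fun m => ?_)
    rw [Nat.factorial_succ]
    push_cast
    field_simp
    ring
  refine Summable.of_norm_bounded (h.mul_right (w / a + 1)) fun m => ?_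
  rw [momentTerm, ← mul_assoc, norm_mul, Real.norm_of_nonneg (by positivity), Real.norm_eq_abs]
  gcongr
  exact abs_div_natCast_add_sub_one_le ha hw m

lemma summable_momentTerm {a w : ℝ} (ha : 0 < a) (hw : 0 ≤ w) : Summable (momentTerm a w) := by
  refine Summable.of_norm_bounded
    ((Real.summable_pow_div_factorial w).mul_right (w / a + 1)) fun m => ?_
  rw [momentTerm, norm_mul, Real.norm_of_nonneg (by positivity), Real.norm_eq_abs]
  gcongr
  exact abs_div_natCast_add_sub_one_le ha hw m

lemma hasSum_derivCoeff_derivCoeff_qCoeff {a w : ℝ} (ha : 0 < a) (hw : 0 ≤ w) :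
    HasSum (fun m : ℕ => derivCoeff (derivCoeff (qCoeff a w)) m * Real.Gamma (m + (a + 1)))
      (-(a * ∑' m : ℕ, momentTerm a w m)) := by
  simp only [derivCoeff_derivCoeff_qCoeff_mul_Gamma ha]
  have h := (summable_natCast_mul_momentTerm ha hw).hasSum
  have h1 := (hasSum_nat_add_iff' 1).2 h
  convert! (h1.sub h).sub ((summable_momentTerm ha hw).hasSum.mul_left a) using 1
  simp

lemma one_add_mul_abs_tsum_momentTerm_le {a w : ℝ} (ha : 0 < a) (hw : 0 ≤ w) :
    (1 + w) * |∑' m : ℕ, momentTerm a w m|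
      ≤ (1 + 2 * ((1 + a) * (1 + 2 / a))) * Real.exp w := by
  set C := (1 + a) * (1 + 2 / a) with hC
  have hC0 : 0 ≤ C := by positivity
  set p : ℕ → ℝ := fun m => w ^ m / (m.factorial : ℝ) with hp
  have hp0 : ∀ m, 0 ≤ p m := fun m => by simp only [hp]; positivity
  have hps : HasSum p (Real.exp w) := by
    rw [Real.exp_eq_exp_ℝ]; exact NormedSpace.expSeries_div_hasSum_exp w
  have hsucc : ∀ m : ℕ, p (m + 1) = w / (m + 1) * p m := fun m => by
    simp only [hp]; rw [Nat.factorial_succ]; push_cast; field_simp; ring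
  have hp1 := (hasSum_nat_add_iff' 1).2 hps
  have hp2 := (hasSum_nat_add_iff' 2).2 hps
  set F : ℕ → ℝ := fun m => p (m + 1) / (m + 2) with hF
  have hF0 : ∀ m, 0 ≤ F m := fun m => div_nonneg (hp0 _) (by positivity)
  have hFle : ∀ m, F m ≤ p (m + 1) := fun m =>
    div_le_self (hp0 _) (by linarith [(Nat.cast_nonneg m : (0 : ℝ) ≤ m)])
  have hFs : Summable F := Summable.of_nonneg_of_le hF0 hFle hp1.summable
  have hF1 : ∑' m, F m ≤ Real.exp w := by
    refine (hFs.tsum_le_tsum hFle hp1.summable).trans ?_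
    rw [hp1.tsum_eq]
    simp [hp]
  have hF2 : w * ∑' m, F m ≤ Real.exp w := by
    have : ∀ m, w * F m = p (m + 2) := fun m => by
      rw [hsucc (m + 1)]; simp only [hF]; push_cast; ring
    rw [← tsum_mul_left, tsum_congr this, hp2.tsum_eq]
    simp [Finset.sum_range_succ, hp, hw, add_nonneg]
  set B : ℕ → ℝ := fun m => momentTerm a w m - (p (m + 1) - p m) with hB
  have hBle : ∀ m, ‖B m‖ ≤ C * F m := by
    intro m
    have hma : 0 < (m : ℝ) + a := by positivity
    have hm : (0 : ℝ) ≤ m := by positivity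
    have e : B m = (1 - a) * ((m + 2) / (m + a)) * F m := by
      simp only [hB, hF, momentTerm]
      rw [hsucc]
      simp only [hp]
      field_simp
      ring
    rw [e, norm_mul, norm_mul, Real.norm_of_nonneg (hF0 m), Real.norm_eq_abs,
      Real.norm_of_nonneg (by positivity)]
    have h1 : |1 - a| ≤ 1 + a := by rw [abs_le]; constructor <;> linarith
    have h2 : ((m : ℝ) + 2) / (m + a) ≤ 1 + 2 / a := by
      rw [div_le_iff₀ hma]
      have : 2 / a * (m + a) = 2 / a * m + 2 := by field_simp
      have : 0 ≤ 2 / a * m := by positivity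
      nlinarith
    have := hF0 m
    rw [hC]
    gcongr
  have hBs : Summable B := Summable.of_norm_bounded (hFs.mul_left C) hBle
  have hsum : ∑' m, momentTerm a w m = -1 + ∑' m, B m := by
    have h := (hp1.sub hps).add hBs.hasSum
    refine (HasSum.tsum_eq ?_)
    convert! h using 1
    · ext m; simp only [hB]; ring
    · simp [hp]
  have hBt : |∑' m, B m| ≤ C * ∑' m, F m := by
    rw [← tsum_mul_left]
    exact tsum_of_norm_bounded (hFs.mul_left C).hasSum hBle
  have habs : |∑' m, momentTerm a w m| ≤ 1 + C * ∑' m, F m := by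
    rw [hsum]
    refine (abs_add_le _ _).trans ?_
    simpa using hBt
  have hexp : 1 + w ≤ Real.exp w := by linarith [Real.add_one_le_exp w]
  calc (1 + w) * |∑' m, momentTerm a w m| ≤ (1 + w) * (1 + C * ∑' m, F m) := by gcongr
    _ = (1 + w) + C * (∑' m, F m + w * ∑' m, F m) := by ring
    _ ≤ Real.exp w + C * (Real.exp w + Real.exp w) := by gcongr
    _ = _ := by ring

lemma qdens_eq_expNegSeries (b γ t z y : ℝ) :
    qdens b γ t z y = (γ * t) ^ (-(b / γ)) * Real.exp (-(y / (γ * t))) *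
      expNegSeries (qCoeff (b / γ) (y / (γ * t))) (z / (γ * t)) := by
  have h : -(z + y) / (γ * t) = -(y / (γ * t)) + -(z / (γ * t)) := by ring
  rw [qdens, expNegSeries, h, Real.exp_add, tsum_congr fun m => mul_right_comm _ _ _]
  simp only [qCoeff]
  ring

lemma integral_deriv_qdens {b γ t y : ℝ} (hb : 0 < b) (hγ : 0 < γ) (ht : 0 < t) (hy : 0 ≤ y) :
    ∫ z in Set.Ioi (0 : ℝ), deriv (fun z' => qdens b γ t z' y) z * z ^ (b / γ - 1)
      = (γ * t)⁻¹ * (Real.exp (-(y / (γ * t))) *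
        ∑' m : ℕ, momentTerm (b / γ) (y / (γ * t)) m) := by
  have hs : 0 < γ * t := by positivity
  have ha : 0 < b / γ := by positivity
  have hw : 0 ≤ y / (γ * t) := by positivity
  have hc := entireCoeff_qCoeff ha hw
  simp only [qdens_eq_expNegSeries, (hasDerivAt_expNegSeries_div hc _ _ _).deriv]
  simp only [mul_assoc _ (expNegSeries _ _)]
  rw [integral_const_mul, integral_expNegSeries_div_mul_rpow ha hs]
  · simp only [derivCoeff_qCoeff_mul_Gamma ha]
    rw [Real.rpow_neg hs.le]
    have := (Real.rpow_pos_of_pos hs (b / γ)).ne'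
    field_simp
  · simp only [derivCoeff_qCoeff_mul_Gamma ha]
    exact summable_momentTerm ha hw

lemma integral_iteratedDeriv_two_qdens {b γ t y : ℝ} (hb : 0 < b) (hγ : 0 < γ) (ht : 0 < t)
    (hy : 0 ≤ y) :
    ∫ z in Set.Ioi (0 : ℝ), z * iteratedDeriv 2 (fun z' => qdens b γ t z' y) z * z ^ (b / γ - 1)
      = -(b / γ) * ((γ * t)⁻¹ * (Real.exp (-(y / (γ * t))) *
        ∑' m : ℕ, momentTerm (b / γ) (y / (γ * t)) m)) := by
  have hs : 0 < γ * t := by positivity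
  have ha : 0 < b / γ := by positivity
  have hw : 0 ≤ y / (γ * t) := by positivity
  have hc := entireCoeff_qCoeff ha hw
  have hsum := hasSum_derivCoeff_derivCoeff_qCoeff ha hw
  have hint := integral_expNegSeries_div_mul_rpow (by positivity : 0 < b / γ + 1) hs hsum.summable
  rw [hsum.tsum_eq] at hint
  set K := (γ * t) ^ (-(b / γ)) * Real.exp (-(y / (γ * t))) with hK
  have hderiv (z : ℝ) : iteratedDeriv 2 (fun z' => qdens b γ t z' y) z = K / (γ * t) / (γ * t) *
      expNegSeries (derivCoeff (derivCoeff (qCoeff (b / γ) (y / (γ * t))))) (z / (γ * t)) := by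
    have h1 : deriv (fun z' => qdens b γ t z' y) = fun z => K / (γ * t) *
        expNegSeries (derivCoeff (qCoeff (b / γ) (y / (γ * t)))) (z / (γ * t)) := by
      funext z
      simp only [qdens_eq_expNegSeries]
      exact (hasDerivAt_expNegSeries_div hc _ _ z).deriv
    rw [iteratedDeriv_succ, iteratedDeriv_one, h1]
    exact (hasDerivAt_expNegSeries_div hc.derivCoeff _ _ z).deriv
  calc _ = ∫ z in Set.Ioi (0 : ℝ), K / (γ * t) / (γ * t) *
        (expNegSeries (derivCoeff (derivCoeff (qCoeff (b / γ) (y / (γ * t))))) (z / (γ * t))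
          * z ^ (b / γ + 1 - 1)) := by
        refine setIntegral_congr_fun measurableSet_Ioi fun z hz => ?_
        have hz : 0 < z := hz
        rw [hderiv, show b / γ + 1 - 1 = (b / γ - 1) + 1 by ring, Real.rpow_add_one hz.ne']
        ring
    _ = _ := by
        rw [integral_const_mul, hint, hK, Real.rpow_add_one hs.ne', Real.rpow_neg hs.le]
        have := (Real.rpow_pos_of_pos hs (b / γ)).ne'
        field_simp

/-- For every `M ≥ 1` there is a constant `c = c(M)` such that for all `b, γ > 0` with
`max(γ, γ⁻¹, b, b⁻¹) ≤ M`, all `t > 0` and all `y ≥ 0`, and for `D̃` equal either to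
`z ↦ ∂_z` or to `z ↦ z ∂²_z` (acting in the `z`-variable):
`| ∫_0^∞ (D̃_z q_t^{b,γ})(z,y) z^{b/γ−1} dz | ≤ c (t + y)⁻¹`. -/
theorem qdens_deriv_integral_bound (M : ℝ) (hM : 1 ≤ M) :
    ∃ c : ℝ, 0 < c ∧ ∀ b γ t : ℝ, 0 < b → 0 < γ →
      max (max γ γ⁻¹) (max b b⁻¹) ≤ M → 0 < t → ∀ y : ℝ, 0 ≤ y →
      |∫ z in Set.Ioi (0 : ℝ),
          deriv (fun z' => qdens b γ t z' y) z * z ^ (b / γ - 1)| ≤ c * (t + y)⁻¹ ∧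
      |∫ z in Set.Ioi (0 : ℝ),
          z * iteratedDeriv 2 (fun z' => qdens b γ t z' y) z * z ^ (b / γ - 1)|
        ≤ c * (t + y)⁻¹ := by
  have hM0 : 0 < M := by linarith
  set C := 1 + 2 * ((1 + M * M) * (1 + 2 * (M * M))) with hC
  have hC0 : 0 < C := by positivity
  refine ⟨M * M * (C * M), by positivity, fun b γ t hb hγ hmax ht y hy => ?_⟩
  simp only [max_le_iff] at hmax
  obtain ⟨⟨hγM, hγM'⟩, hbM, hbM'⟩ := hmax
  rw [integral_deriv_qdens hb hγ ht hy, integral_iteratedDeriv_two_qdens hb hγ ht hy]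
  set s := γ * t with hsdef
  set w := y / s with hwdef
  set a := b / γ with hadef
  have hs : 0 < s := by positivity
  have hw : 0 ≤ w := by positivity
  have ha : 0 < a := by positivity
  have haM : a ≤ M * M := by
    rw [hadef, div_eq_mul_inv]; gcongr
  have haM' : 2 / a ≤ 2 * (M * M) := by
    rw [hadef, show 2 / (b / γ) = 2 * (γ * b⁻¹) by field_simp]; gcongr
  have hsy : t + y ≤ M * (s + y) := by
    have h1 : 1 ≤ M * γ := by
      have := mul_le_mul_of_nonneg_right hγM' hγ.le
      rwa [inv_mul_cancel₀ hγ.ne'] at this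
    rw [hsdef]
    nlinarith [mul_le_mul_of_nonneg_right h1 ht.le, mul_le_mul_of_nonneg_right hM hy]
  set S := ∑' m : ℕ, momentTerm a w m
  have hS : (1 + w) * |S| ≤ C * Real.exp w := by
    refine (one_add_mul_abs_tsum_momentTerm_le ha hw).trans ?_
    rw [hC]
    gcongr
  have hmain : |s⁻¹ * (Real.exp (-w) * S)| ≤ C * M * (t + y)⁻¹ := by
    have h1 : (1 + w) * (Real.exp (-w) * |S|) ≤ C := by
      calc (1 + w) * (Real.exp (-w) * |S|) = Real.exp (-w) * ((1 + w) * |S|) := by ring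
        _ ≤ Real.exp (-w) * (C * Real.exp w) := by gcongr
        _ = C := by rw [mul_left_comm, ← Real.exp_add]; simp
    rw [abs_mul, abs_mul, Real.abs_exp, abs_of_pos (inv_pos.2 hs), ← div_eq_mul_inv (C * M),
      le_div_iff₀ (by positivity)]
    have h2 : s + y = s * (1 + w) := by rw [hwdef]; field_simp
    calc s⁻¹ * (Real.exp (-w) * |S|) * (t + y)
        ≤ s⁻¹ * (Real.exp (-w) * |S|) * (M * (s + y)) := by gcongr
      _ = M * ((1 + w) * (Real.exp (-w) * |S|)) := by rw [h2]; field_simp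
      _ ≤ M * C := by gcongr
      _ = C * M := mul_comm _ _
  have hty : 0 ≤ C * M * (t + y)⁻¹ := by positivity
  constructor
  · refine hmain.trans ?_
    rw [mul_assoc (M * M)]
    exact le_mul_of_one_le_left hty (by nlinarith)
  · rw [abs_mul, abs_neg, abs_of_pos ha, mul_assoc (M * M)]
    gcongr
end
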